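/- For any sequence of outcomes x ∈ {0,1}^T and predictions p ∈ [0,1]^T, the V-Calibration error VCal(x,p) := sup_{α,β ∈ [0,1]} [Σ_{t=1}^T (x_t − α)·sgn(α − p_t) − Σ_{t=1}^T (x_t − α)·sgn(α − β)] equals 2·sup_{α ∈ [0,1]} max{X₋(α) − α·N₋(α), α·N₊(α) − X₊(α)}, where N₋(α) = #{t : p_t < α}, N₊(α) = #{t : p_t > α}, X₋(α) = Σ_t x_t·1[p_t < α], and X₊(α) = Σ_t x_t·1[p_t > α]. -/

import Mathlib

open Finset

lemma aux_right {T : ℕ} (p : Fin T → ℝ) (α : ℝ) (h1 : α < 1) :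
    ∀ᶠ a in nhdsWithin α (Set.Ioi α), α < a ∧ a < 1 ∧ ∀ t, α < p t → a < p t := by
  have e1 : ∀ᶠ a in nhdsWithin α (Set.Ioi α), α < a := eventually_mem_nhdsWithin
  have e2 : ∀ᶠ a in nhdsWithin α (Set.Ioi α), a < 1 :=
    nhdsWithin_le_nhds (eventually_lt_nhds h1)
  have e3 : ∀ᶠ a in nhdsWithin α (Set.Ioi α), ∀ t, α < p t → a < p t := by
    rw [Filter.eventually_all]
    intro t
    by_cases h : α < p t
    · have : ∀ᶠ a in nhdsWithin α (Set.Ioi α), a < p t :=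
        nhdsWithin_le_nhds (eventually_lt_nhds h)
      filter_upwards [this] with a ha _ using ha
    · exact Filter.Eventually.of_forall fun a h' => absurd h' h
  filter_upwards [e1, e2, e3] with a h1 h2 h3 using ⟨h1, h2, h3⟩

lemma aux_left {T : ℕ} (p : Fin T → ℝ) (α : ℝ) (h1 : 0 < α) :
    ∀ᶠ a in nhdsWithin α (Set.Iio α), a < α ∧ 0 < a ∧ ∀ t, p t < α → p t < a := by
  have e1 : ∀ᶠ a in nhdsWithin α (Set.Iio α), a < α := eventually_mem_nhdsWithin
  have e2 : ∀ᶠ a in nhdsWithin α (Set.Iio α), 0 < a :=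
    nhdsWithin_le_nhds (eventually_gt_nhds h1)
  have e3 : ∀ᶠ a in nhdsWithin α (Set.Iio α), ∀ t, p t < α → p t < a := by
    rw [Filter.eventually_all]
    intro t
    by_cases h : p t < α
    · have : ∀ᶠ a in nhdsWithin α (Set.Iio α), p t < a :=
        nhdsWithin_le_nhds (eventually_gt_nhds h)
      filter_upwards [this] with a ha _ using ha
    · exact Filter.Eventually.of_forall fun a h' => absurd h' h
  filter_upwards [e1, e2, e3] with a h1 h2 h3 using ⟨h1, h2, h3⟩

lemma lim_right {T : ℕ} (x p : Fin T → ℝ) (M α : ℝ) (h0 : 0 ≤ α) (h1 : α < 1)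
    (hM : ∀ a ∈ Set.Icc (0:ℝ) 1, (∑ t, if p t < a then x t - a else 0) ≤ M) :
    (∑ t, if p t ≤ α then x t - α else 0) ≤ M := by
  have ht : Filter.Tendsto (fun a : ℝ => ∑ t, if p t ≤ α then x t - a else 0)
      (nhdsWithin α (Set.Ioi α)) (nhds (∑ t, if p t ≤ α then x t - α else 0)) := by
    apply Filter.Tendsto.mono_left _ nhdsWithin_le_nhds
    apply tendsto_finsetSum
    intro t _
    split_ifs
    · exact tendsto_const_nhds.sub Filter.tendsto_id
    · exact tendsto_const_nhds
  refine le_of_tendsto ht ?_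
  filter_upwards [aux_right p α h1] with a ⟨ha, hb, hc⟩
  refine le_trans (le_of_eq ?_) (hM a ⟨by linarith, hb.le⟩)
  refine Finset.sum_congr rfl fun t _ => ?_
  have := hc t
  have h : p t ≤ α ↔ p t < a :=
    ⟨fun h => by linarith, fun h => by by_contra h'; linarith [this (not_le.mp h')]⟩
  simp only [h]

lemma lim_left {T : ℕ} (x p : Fin T → ℝ) (M α : ℝ) (h0 : 0 < α) (h1 : α ≤ 1)
    (hM : ∀ a ∈ Set.Icc (0:ℝ) 1, (∑ t, if a < p t then a - x t else 0) ≤ M) :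
    (∑ t, if α ≤ p t then α - x t else 0) ≤ M := by
  have ht : Filter.Tendsto (fun a : ℝ => ∑ t, if α ≤ p t then a - x t else 0)
      (nhdsWithin α (Set.Iio α)) (nhds (∑ t, if α ≤ p t then α - x t else 0)) := by
    apply Filter.Tendsto.mono_left _ nhdsWithin_le_nhds
    apply tendsto_finsetSum
    intro t _
    split_ifs
    · exact Filter.tendsto_id.sub tendsto_const_nhds
    · exact tendsto_const_nhds
  refine le_of_tendsto ht ?_
  filter_upwards [aux_left p α h0] with a ⟨ha, hb, hc⟩
  refine le_trans (le_of_eq ?_) (hM a ⟨hb.le, by linarith⟩)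
  refine Finset.sum_congr rfl fun t _ => ?_
  have := hc t
  have h : α ≤ p t ↔ a < p t :=
    ⟨fun h => by linarith, fun h => by by_contra h'; linarith [this (not_le.mp h')]⟩
  simp only [h]

lemma val_lt {T : ℕ} (x p : Fin T → ℝ) (α β : ℝ) (h : α < β) :
    (∑ t, (x t - α) * Real.sign (α - p t)) - ∑ t, (x t - α) * Real.sign (α - β)
    = (∑ t, if p t < α then x t - α else 0) + ∑ t, if p t ≤ α then x t - α else 0 := by
  rw [← Finset.sum_sub_distrib, ← Finset.sum_add_distrib]
  refine Finset.sum_congr rfl fun t _ => ?_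
  rw [Real.sign_of_neg (sub_neg.mpr h)]
  rcases lt_trichotomy (p t) α with h | h | h
  · rw [Real.sign_of_pos (sub_pos.mpr h), if_pos h, if_pos h.le]; ring
  · simp [h]
  · rw [Real.sign_of_neg (sub_neg.mpr h), if_neg h.not_gt, if_neg h.not_ge]; ring

lemma val_gt {T : ℕ} (x p : Fin T → ℝ) (α β : ℝ) (h : β < α) :
    (∑ t, (x t - α) * Real.sign (α - p t)) - ∑ t, (x t - α) * Real.sign (α - β)
    = (∑ t, if α < p t then α - x t else 0) + ∑ t, if α ≤ p t then α - x t else 0 := by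
  rw [← Finset.sum_sub_distrib, ← Finset.sum_add_distrib]
  refine Finset.sum_congr rfl fun t _ => ?_
  rw [Real.sign_of_pos (sub_pos.mpr h)]
  rcases lt_trichotomy (p t) α with h | h | h
  · rw [Real.sign_of_pos (sub_pos.mpr h), if_neg h.not_gt, if_neg h.not_ge]; ring
  · simp [h]
  · rw [Real.sign_of_neg (sub_neg.mpr h), if_pos h, if_pos h.le]; ring

lemma val_eq {T : ℕ} (x p : Fin T → ℝ) (α : ℝ) :
    (∑ t, (x t - α) * Real.sign (α - p t)) - ∑ t, (x t - α) * Real.sign (α - α)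
    = (∑ t, if p t < α then x t - α else 0) + ∑ t, if α < p t then α - x t else 0 := by
  rw [← Finset.sum_sub_distrib, ← Finset.sum_add_distrib]
  refine Finset.sum_congr rfl fun t _ => ?_
  rw [sub_self, Real.sign_zero]
  rcases lt_trichotomy (p t) α with h | h | h
  · rw [Real.sign_of_pos (sub_pos.mpr h), if_neg h.not_gt, if_pos h]; ring
  · simp [h]
  · rw [Real.sign_of_neg (sub_neg.mpr h), if_pos h, if_neg h.not_gt]; ring

/-- alternative form of the V-Calibration error. -/
theorem vcal_alt_form (T : ℕ) (x p : Fin T → ℝ)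
    (hx : ∀ t, x t = 0 ∨ x t = 1) (hp : ∀ t, p t ∈ Set.Icc (0:ℝ) 1) :
    sSup {v : ℝ | ∃ α ∈ Set.Icc (0:ℝ) 1, ∃ β ∈ Set.Icc (0:ℝ) 1,
        v = (∑ t, (x t - α) * Real.sign (α - p t))
            - ∑ t, (x t - α) * Real.sign (α - β)} =
      2 * sSup {v : ℝ | ∃ α ∈ Set.Icc (0:ℝ) 1,
        v = max ((∑ t, x t * (if p t < α then (1:ℝ) else 0))
                  - α * ∑ t, (if p t < α then (1:ℝ) else 0))
                (α * (∑ t, (if α < p t then (1:ℝ) else 0))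
                  - ∑ t, x t * (if α < p t then (1:ℝ) else 0))} := by
  have eA : ∀ α : ℝ, (∑ t, x t * (if p t < α then (1:ℝ) else 0))
      - α * ∑ t, (if p t < α then (1:ℝ) else 0) = ∑ t, if p t < α then x t - α else 0 := by
    intro α
    rw [Finset.mul_sum, ← Finset.sum_sub_distrib]
    refine Finset.sum_congr rfl fun t _ => ?_
    split_ifs <;> ring
  have eB : ∀ α : ℝ, (α * (∑ t, (if α < p t then (1:ℝ) else 0))
      - ∑ t, x t * (if α < p t then (1:ℝ) else 0)) = ∑ t, if α < p t then α - x t else 0 := by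
    intro α
    rw [Finset.mul_sum, ← Finset.sum_sub_distrib]
    refine Finset.sum_congr rfl fun t _ => ?_
    split_ifs <;> ring
  simp only [eA, eB]
  have hx0 : ∀ t, 0 ≤ x t := fun t => by rcases hx t with h | h <;> rw [h] <;> norm_num
  have hx1 : ∀ t, x t ≤ 1 := fun t => by rcases hx t with h | h <;> rw [h] <;> norm_num
  set R : Set ℝ := {v : ℝ | ∃ α ∈ Set.Icc (0:ℝ) 1,
        v = max (∑ t, if p t < α then x t - α else 0) (∑ t, if α < p t then α - x t else 0)}
    with hR
  set L : Set ℝ := {v : ℝ | ∃ α ∈ Set.Icc (0:ℝ) 1, ∃ β ∈ Set.Icc (0:ℝ) 1,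
        v = (∑ t, (x t - α) * Real.sign (α - p t))
            - ∑ t, (x t - α) * Real.sign (α - β)} with hL
  have bR : BddAbove R := by
    refine ⟨∑ t : Fin T, (1:ℝ), ?_⟩
    rintro v ⟨α, ⟨h0, h1⟩, rfl⟩
    refine max_le (Finset.sum_le_sum fun t _ => ?_) (Finset.sum_le_sum fun t _ => ?_)
    · split_ifs <;> linarith [hx1 t]
    · split_ifs <;> linarith [hx0 t]
  have mA : ∀ a ∈ Set.Icc (0:ℝ) 1, (∑ t, if p t < a then x t - a else 0) ≤ sSup R :=
    fun a ha => (le_max_left _ _).trans (le_csSup bR ⟨a, ha, rfl⟩)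
  have mB : ∀ a ∈ Set.Icc (0:ℝ) 1, (∑ t, if a < p t then a - x t else 0) ≤ sSup R :=
    fun a ha => (le_max_right _ _).trans (le_csSup bR ⟨a, ha, rfl⟩)
  have up : ∀ v ∈ L, v ≤ 2 * sSup R := by
    rintro v ⟨α, hα, β, hβ, rfl⟩
    rcases lt_trichotomy α β with h | h | h
    · rw [val_lt x p α β h]
      linarith [mA α hα, lim_right x p _ α hα.1 (h.trans_le hβ.2) mA]
    · subst h
      rw [val_eq]
      linarith [mA α hα, mB α hα]
    · rw [val_gt x p α β h]
      linarith [mB α hα, lim_left x p _ α (hβ.1.trans_lt h) hα.2 mB]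
  have bL : BddAbove L := ⟨_, up⟩
  have i0 : (0:ℝ) ∈ Set.Icc (0:ℝ) 1 := ⟨le_rfl, zero_le_one⟩
  have i1 : (1:ℝ) ∈ Set.Icc (0:ℝ) 1 := ⟨zero_le_one, le_rfl⟩
  have L0 : 0 ≤ sSup L := by
    refine le_trans ?_ (le_csSup bL ⟨0, i0, 1, i1, rfl⟩)
    rw [val_lt x p 0 1 one_pos]
    refine add_nonneg (Finset.sum_nonneg fun t _ => ?_) (Finset.sum_nonneg fun t _ => ?_) <;>
      split_ifs <;> linarith [hx0 t]
  apply le_antisymm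
  · exact csSup_le ⟨_, 0, i0, 0, i0, rfl⟩ up
  · have : sSup R ≤ sSup L / 2 := by
      refine csSup_le ⟨_, 0, i0, rfl⟩ ?_
      rintro v ⟨α, hα, rfl⟩
      refine max_le ?_ ?_
      · rcases hα.1.eq_or_lt with h | h
        · subst h
          refine le_trans (Finset.sum_nonpos fun t _ => ?_) (by linarith)
          rw [if_neg (not_lt.mpr (hp t).1)]
        · obtain ⟨a, h1, h2, h3⟩ := (aux_left p α h).exists
          have hle := le_csSup bL ⟨a, ⟨h2.le, by linarith [hα.2]⟩, 1, i1, rfl⟩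
          rw [val_lt x p a 1 (by linarith [hα.2])] at hle
          have k1 : (∑ t, if p t < α then x t - α else 0)
              ≤ ∑ t, if p t < a then x t - a else 0 := by
            refine Finset.sum_le_sum fun t _ => ?_
            have := h3 t
            split_ifs <;> grind
          have k2 : (∑ t, if p t < α then x t - α else 0)
              ≤ ∑ t, if p t ≤ a then x t - a else 0 := by
            refine Finset.sum_le_sum fun t _ => ?_
            have := h3 t
            split_ifs <;> grind
          linarith
      · rcases hα.2.eq_or_lt with h | h
        · subst h
          refine le_trans (Finset.sum_nonpos fun t _ => ?_) (by linarith)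
          rw [if_neg (not_lt.mpr (hp t).2)]
        · obtain ⟨a, h1, h2, h3⟩ := (aux_right p α h).exists
          have hle := le_csSup bL ⟨a, ⟨by linarith [hα.1], h2.le⟩, 0, i0, rfl⟩
          rw [val_gt x p a 0 (by linarith [hα.1])] at hle
          have k1 : (∑ t, if α < p t then α - x t else 0)
              ≤ ∑ t, if a < p t then a - x t else 0 := by
            refine Finset.sum_le_sum fun t _ => ?_
            have := h3 t
            split_ifs <;> grind
          have k2 : (∑ t, if α < p t then α - x t else 0)
              ≤ ∑ t, if a ≤ p t then a - x t else 0 := by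
            refine Finset.sum_le_sum fun t _ => ?_
            have := h3 t
            split_ifs <;> grind
          linarith
    linarith
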